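/- arXiv:2103.14707 — 4 statements merged into one kernel-verified Lean document; each statement's English description precedes it below -/
import Mathlib

section
/- Let k ≥ 1 and m ≥ 0. In the polynomial ring A⟨k⟩ = F₂[ξ₁, …, ξ_k], for every integer n > m the element ζ̄_n lies in the ideal generated by ζ̄_{m+1}, ζ̄_{m+2}, …, ζ̄_{m+k}. -/
open MvPolynomial

/-- The dual Steenrod algebra `A = F₂[ξ₁, ξ₂, …]`; the variable `X i` represents `ξ_{i+1}`. -/
noncomputable abbrev DualSteenrod : Type := MvPolynomial ℕ (ZMod 2)

/-- The conjugate classes, via Milnor's recursion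
`ζ_n = ∑_{i=1}^{n} ξ_i^{2^{n−i}} ζ_{n−i}` (with `ζ_0 = 1`). -/
noncomputable def zeta : ℕ → DualSteenrod
  | 0 => 1
  | (n+1) => ∑ i ∈ Finset.range (n+1), (X i) ^ (2^(n-i)) * zeta (n-i)
  decreasing_by omega

/-- The projection `A → A⟨k⟩ = F₂[ξ₁, …, ξ_k]`, killing `ξ_i` for `i > k`.
In `MvPolynomial (Fin k) (ZMod 2)`, the variable `X i` represents `ξ_{i+1}`. -/
noncomputable def proj (k : ℕ) :
    DualSteenrod →ₐ[ZMod 2] MvPolynomial (Fin k) (ZMod 2) :=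
  aeval (fun i => if h : i < k then X (⟨i, h⟩ : Fin k) else 0)

/-- `ζ̄_n`, the image of `ζ_n` in `A⟨k⟩`. -/
noncomputable def zetaBar (k n : ℕ) : MvPolynomial (Fin k) (ZMod 2) :=
  proj k (zeta n)

theorem proj_X_of_le {k i : ℕ} (h : k ≤ i) : proj k (X i) = 0 := by
  simp [proj, Nat.not_lt.mpr h]

theorem zetaBar_succ (k n : ℕ) : zetaBar k (n + 1) =
    ∑ i ∈ Finset.range (n + 1), proj k (X i) ^ (2 ^ (n - i)) * zetaBar k (n - i) := by
  simp only [zetaBar]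
  rw [zeta]
  simp only [map_sum, map_mul, map_pow]

/-- For `k ≥ 1`, `m ≥ 0` and every `n > m`, the element `ζ̄_n` of
`A⟨k⟩ = F₂[ξ₁, …, ξ_k]` lies in the ideal generated by `ζ̄_{m+1}, …, ζ̄_{m+k}`. -/
theorem zetaBar_mem_span (k m : ℕ) (hk : 1 ≤ k) :
    ∀ n > m, zetaBar k n ∈
      Ideal.span (Set.range fun i : Fin k => zetaBar k (m + 1 + (i : ℕ))) := by
  intro n
  induction n using Nat.strong_induction_on with
  | _ n ih =>
    intro hn
    by_cases hle : n ≤ m + k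
    · exact Ideal.subset_span ⟨⟨n - (m + 1), by omega⟩, congrArg (zetaBar k) (by grind)⟩
    · obtain ⟨n, rfl⟩ : ∃ l, n = l + 1 := ⟨n - 1, by omega⟩
      rw [zetaBar_succ]
      refine Ideal.sum_mem _ fun i _ => ?_
      rcases lt_or_ge i k with hik | hik
      · exact Ideal.mul_mem_left _ _ (ih (n - i) (by omega) (by omega))
      · simp [proj_X_of_le hik]
end

section
/- Let I and J be cofinite subsets of the positive integers, and let B be the quotient of A by the ideal generated by all ξ_i with i ∈ I together with all ζ_j with j ∈ J. Then B is finite-dimensional as an F₂-vector space, B has Krull dimension zero, and the image in B of every ξ_i (i ≥ 1) is nilpotent. -/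
open MvPolynomial

theorem zeta_succ (n : ℕ) :
    zeta (n + 1) = ∑ i ∈ Finset.range (n + 1), (X i) ^ (2 ^ (n - i)) * zeta (n - i) := by
  rw [zeta]

theorem constantCoeff_zeta {n : ℕ} (hn : 1 ≤ n) : constantCoeff (zeta n) = 0 := by
  obtain ⟨m, rfl⟩ := Nat.exists_eq_add_of_le' hn
  simp [zeta_succ]

theorem exists_last_ne_zero {M : Type*} [Zero M] (u : ℕ → M) {k : ℕ}
    (hu : ∀ i, k ≤ i → u i = 0) {i : ℕ} (hi : u i ≠ 0) :
    ∃ a, u a ≠ 0 ∧ ∀ l, a < l → u l = 0 := by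
  classical
  have hik : i ≤ k := by by_contra h; exact hi (hu i (by omega))
  refine ⟨_, Nat.findGreatest_spec (P := fun i => u i ≠ 0) hik hi, fun l hl => ?_⟩
  by_cases hlk : l ≤ k
  · simpa using Nat.findGreatest_is_greatest hl hlk
  · exact hu l (by omega)

/-- If a ring homomorphism to a domain kills all but finitely many `ξ_i` and `ζ_j`,
then it kills every `ξ_i`: the product of the last surviving classes is
the only term left in one of Milnor's relations. -/
theorem map_X_eq_zero_of_eventually_zero {R : Type*} [CommRing R] [IsDomain R]
    (f : DualSteenrod →+* R) {k m : ℕ} (hX : ∀ i, k ≤ i → f (X i) = 0)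
    (hzeta : ∀ j, m ≤ j → f (zeta j) = 0) (i : ℕ) : f (X i) = 0 := by
  by_contra hi
  obtain ⟨a, ha, ha'⟩ := exists_last_ne_zero (fun l => f (X l)) hX hi
  obtain ⟨b, hb, hb'⟩ := exists_last_ne_zero (fun j => f (zeta j)) hzeta (i := 0) (by simp [zeta])
  have h := hb' (a + b + 1) (by omega)
  rw [zeta_succ, map_sum, Finset.sum_eq_single a] at h
  · simp only [map_mul, map_pow, Nat.add_sub_cancel_left] at h
    exact mul_ne_zero (pow_ne_zero _ ha) hb h
  · intro l _ hla
    rcases lt_or_gt_of_ne hla with hl | hl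
    · simp [hb' (a + b - l) (by omega)]
    · simp [ha' l hl]
  · intro hmem
    exact absurd (Finset.mem_range.mpr (by omega)) hmem

theorem X_mem_radical_of_eventually_mem (K : Ideal DualSteenrod) {k m : ℕ}
    (hX : ∀ i, k ≤ i → X i ∈ K) (hzeta : ∀ j, m ≤ j → zeta j ∈ K) (i : ℕ) :
    X i ∈ K.radical := by
  rw [Ideal.radical_eq_sInf, Ideal.mem_sInf]
  rintro P ⟨hKP, hP⟩
  rw [← Ideal.Quotient.eq_zero_iff_mem]
  exact map_X_eq_zero_of_eventually_zero (Ideal.Quotient.mk P)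
    (fun i hi => Ideal.Quotient.eq_zero_iff_mem.mpr (hKP (hX i hi)))
    (fun j hj => Ideal.Quotient.eq_zero_iff_mem.mpr (hKP (hzeta j hj))) i

/-- A quotient of a polynomial ring in which almost all variables vanish and
all variables are nilpotent is a finite module. -/
theorem MvPolynomial.finite_quotient_of_isNilpotent {F : Type*} [CommRing F]
    (K : Ideal (MvPolynomial ℕ F)) {k : ℕ} (hX : ∀ i, k ≤ i → X i ∈ K)
    (hnil : ∀ i, IsNilpotent (Ideal.Quotient.mk K (X i))) :
    Module.Finite F (MvPolynomial ℕ F ⧸ K) := by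
  let s : Set (MvPolynomial ℕ F ⧸ K) := Set.range fun i => Ideal.Quotient.mkₐ F K (X i)
  have hs : s.Finite := by
    refine (((Set.finite_Iio k).image
      fun i => Ideal.Quotient.mkₐ F K (X i)).insert 0).subset ?_
    rintro _ ⟨i, rfl⟩
    by_cases hi : i < k
    · exact Or.inr ⟨i, hi, rfl⟩
    · exact Or.inl (Ideal.Quotient.eq_zero_iff_mem.mpr (hX i (by omega)))
  have hint : ∀ x ∈ s, IsIntegral F x := by
    rintro _ ⟨i, rfl⟩
    obtain ⟨n, hn⟩ := hnil i
    refine ⟨Polynomial.X ^ n, Polynomial.monic_X_pow n, ?_⟩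
    simpa using hn
  have htop : Algebra.adjoin F s = ⊤ := by
    have hrange : s = Ideal.Quotient.mkₐ F K '' Set.range X := by
      rw [← Set.range_comp]; rfl
    rw [hrange, ← AlgHom.map_adjoin, adjoin_range_X, Algebra.map_top,
      AlgHom.range_eq_top]
    exact Ideal.Quotient.mkₐ_surjective F K
  have hfg := fg_adjoin_of_finite hs hint
  rw [htop, Algebra.top_toSubmodule] at hfg
  exact ⟨hfg⟩

theorem exists_forall_ge_mem_of_cofinite {S : Set ℕ}
    (hS : ({i : ℕ | 1 ≤ i} \ S).Finite) : ∃ k, ∀ i, k ≤ i → i ∈ S := by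
  obtain ⟨k, hk⟩ := hS.bddAbove
  refine ⟨k + 1, fun i hi => ?_⟩
  by_contra h
  have : i ≤ k := hk ⟨show 1 ≤ i by omega, h⟩
  omega

/-- Let `I` and `J` be cofinite sets of positive integers and let
`B = A/(ξ_i, ζ_j ∣ i ∈ I, j ∈ J)`.  Then `B` is finite-dimensional over `F₂`,
has Krull dimension zero, and the image of every `ξ_i` (`i ≥ 1`) in `B` is nilpotent.
(Recall the variable `X (i-1)` of `DualSteenrod` represents `ξ_i`.) -/
theorem quotient_by_cofinite_xi_zeta (I J : Set ℕ)
    (hI : ∀ i ∈ I, 1 ≤ i) (hJ : ∀ j ∈ J, 1 ≤ j)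
    (hIcof : ({i : ℕ | 1 ≤ i} \ I).Finite) (hJcof : ({j : ℕ | 1 ≤ j} \ J).Finite)
    (K : Ideal DualSteenrod)
    (hK : K = Ideal.span ((fun i => (X (i-1) : DualSteenrod)) '' I ∪ zeta '' J)) :
    FiniteDimensional (ZMod 2) (DualSteenrod ⧸ K) ∧
    ringKrullDim (DualSteenrod ⧸ K) = 0 ∧
    ∀ i : ℕ, 1 ≤ i → IsNilpotent (Ideal.Quotient.mk K (X (i-1))) := by
  obtain ⟨k, hk⟩ := exists_forall_ge_mem_of_cofinite hIcof
  obtain ⟨m, hm⟩ := exists_forall_ge_mem_of_cofinite hJcof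
  have hX : ∀ i, k ≤ i → (X i : DualSteenrod) ∈ K := fun i hi => by
    rw [hK]
    exact Ideal.subset_span (Or.inl ⟨i + 1, hk _ (by omega), by simp⟩)
  have hzeta : ∀ j, m ≤ j → zeta j ∈ K := fun j hj => by
    rw [hK]
    exact Ideal.subset_span (Or.inr ⟨j, hm j hj, rfl⟩)
  have hnil : ∀ i, IsNilpotent (Ideal.Quotient.mk K (X i)) := fun i => by
    obtain ⟨n, hn⟩ := X_mem_radical_of_eventually_mem K hX hzeta i
    exact ⟨n, by rw [← map_pow]; exact Ideal.Quotient.eq_zero_iff_mem.mpr hn⟩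
  have hfin : Module.Finite (ZMod 2) (DualSteenrod ⧸ K) :=
    MvPolynomial.finite_quotient_of_isNilpotent K hX hnil
  have hle : K ≤ RingHom.ker (constantCoeff : DualSteenrod →+* ZMod 2) := by
    rw [hK, Ideal.span_le]
    rintro _ (⟨i, -, rfl⟩ | ⟨j, hj, rfl⟩)
    · exact constantCoeff_X _ _
    · exact constantCoeff_zeta (hJ j hj)
  have : Nontrivial (DualSteenrod ⧸ K) :=
    Ideal.Quotient.nontrivial_iff.mpr
      (ne_top_of_le_ne_top (RingHom.ker_ne_top _) hle)
  have : IsArtinianRing (DualSteenrod ⧸ K) := IsArtinianRing.of_finite (ZMod 2) _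
  exact ⟨hfin, ringKrullDimZero_iff_ringKrullDim_eq_zero.mp inferInstance, fun i _ => hnil (i - 1)⟩
end

section
/- Let k ≥ 1 and m ≥ 0. Equip A⟨k⟩ = F₂[ξ₁, …, ξ_k] with the module structure over the polynomial ring F₂[y₁, …, y_k] given by the F₂-algebra homomorphism sending y_i to ζ̄_{m+i}. Then A⟨k⟩ is a flat F₂[y₁, …, y_k]-module. -/
open MvPolynomial

theorem Module.Free.of_basis_smul {K B S ι κ : Type*} [CommRing K] [CommRing B] [CommRing S]
    [Algebra K B] [Algebra K S] [Algebra B S] [IsScalarTower K B S] (β : Module.Basis ι K B)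
    (w : κ → S) (γ : Module.Basis (Σ _ : κ, ι) K S) (hγ : ∀ p, γ p = β p.2 • w p.1) :
    Module.Free B S := by
  let L := Finsupp.linearCombination B w
  have hL : L.restrictScalars K =
      ((Finsupp.basis fun _ : κ => β).equiv γ (Equiv.refl _)).toLinearMap := by
    refine (Finsupp.basis fun _ : κ => β).ext fun p => ?_
    rw [LinearEquiv.coe_coe, Module.Basis.equiv_apply]
    simp [L, hγ]
  have hbij : Function.Bijective L := by
    have : ⇑L = (Finsupp.basis fun _ : κ => β).equiv γ (Equiv.refl _) := congrArg DFunLike.coe hL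
    rw [this]
    exact LinearEquiv.bijective _
  exact Module.Free.of_basis (Module.Basis.ofRepr (LinearEquiv.ofBijective L hbij).symm)

/-- Euclidean division of exponent vectors. -/
noncomputable def exponentDivMod {σ : Type*} [Finite σ] (D : σ → ℕ) [∀ i, NeZero (D i)] :
    (σ →₀ ℕ) ≃ Σ _ : (∀ i, Fin (D i)), σ →₀ ℕ where
  toFun c := ⟨fun i => Fin.ofNat (D i) (c i), Finsupp.equivFunOnFinite.symm fun i => c i / D i⟩
  invFun p := Finsupp.equivFunOnFinite.symm fun i => p.1 i + D i * p.2 i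
  left_inv c := by
    ext i
    simp [Nat.mod_add_div]
  right_inv p := by
    obtain ⟨a, b⟩ := p
    have hD : ∀ i, 0 < D i := fun i => Nat.pos_of_neZero (D i)
    refine Sigma.ext ?_ (heq_of_eq ?_)
    · ext i
      simp [Nat.mod_eq_of_lt (a i).2]
    · ext i
      simp [Nat.add_mul_div_left _ _ (hD i), Nat.div_eq_of_lt (a i).2]

namespace MvPolynomial

variable {σ K : Type*} [Fintype σ] [Field K]

/-- The linear endomorphism replacing each power `X i ^ D i` in a monomial by `h i`. -/
noncomputable def substPow (D : σ → ℕ) (h : σ → MvPolynomial σ K) :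
    MvPolynomial σ K →ₗ[K] MvPolynomial σ K :=
  (basisMonomials σ K).constr K fun c => ∏ i, h i ^ (c i / D i) * X i ^ (c i % D i)

variable {D : σ → ℕ} {h : σ → MvPolynomial σ K}

theorem substPow_monomial (c : σ →₀ ℕ) :
    substPow D h (monomial c 1) = ∏ i, h i ^ (c i / D i) * X i ^ (c i % D i) := by
  simpa only [coe_basisMonomials, substPow] using (basisMonomials σ K).constr_basis K
    (fun c => ∏ i, h i ^ (c i / D i) * X i ^ (c i % D i)) c

theorem substPow_monomial_of_lt {c : σ →₀ ℕ} (hc : ∀ i, c i < D i) :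
    substPow D h (monomial c 1) = monomial c 1 := by
  rw [substPow_monomial, monomial_eq, Finsupp.prod_fintype _ _ (by simp)]
  simp [Nat.div_eq_of_lt (hc _), Nat.mod_eq_of_lt (hc _)]

theorem isHomogeneous_substPow_monomial (hh : ∀ i, (h i).IsHomogeneous (D i)) (c : σ →₀ ℕ) :
    (substPow D h (monomial c 1)).IsHomogeneous c.degree := by
  rw [substPow_monomial, Finsupp.degree_eq_sum]
  refine IsHomogeneous.prod _ _ _ fun i _ => ?_
  have := ((hh i).pow (c i / D i)).mul (isHomogeneous_X_pow (R := K) i (c i % D i))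
  rwa [Nat.div_add_mod] at this

theorem homogeneousComponent_substPow (hh : ∀ i, (h i).IsHomogeneous (D i)) (n : ℕ)
    (p : MvPolynomial σ K) :
    homogeneousComponent n (substPow D h p) = substPow D h (homogeneousComponent n p) := by
  suffices homogeneousComponent n ∘ₗ substPow D h = substPow D h ∘ₗ homogeneousComponent n from
    LinearMap.congr_fun this p
  refine (basisMonomials σ K).ext fun c => ?_
  simp only [coe_basisMonomials, LinearMap.comp_apply]
  rw [homogeneousComponent_of_mem (isHomogeneous_substPow_monomial hh c),
    homogeneousComponent_of_mem (isHomogeneous_monomial 1 rfl)]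
  split_ifs <;> simp

theorem mul_substPow (hD : ∀ i, 0 < D i) (i : σ) (p : MvPolynomial σ K) :
    h i * substPow D h p = substPow D h (X i ^ D i * p) := by
  classical
  suffices LinearMap.mulLeft K (h i) ∘ₗ substPow D h =
      substPow D h ∘ₗ LinearMap.mulLeft K (X i ^ D i) from LinearMap.congr_fun this p
  refine (basisMonomials σ K).ext fun c => ?_
  simp only [coe_basisMonomials, LinearMap.comp_apply, LinearMap.mulLeft_apply]
  rw [X_pow_eq_monomial, monomial_mul, one_mul, substPow_monomial, substPow_monomial,
    ← Finset.mul_prod_erase _ _ (Finset.mem_univ i),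
    ← Finset.mul_prod_erase (a := i) _ _ (Finset.mem_univ i), ← mul_assoc, ← mul_assoc]
  congr 1
  · simp [Nat.add_div_left _ (hD i), pow_succ']
  · refine Finset.prod_congr rfl fun j hj => ?_
    simp [Finsupp.single_eq_of_ne (Finset.ne_of_mem_erase hj)]

theorem mul_mem_range_substPow (hD : ∀ i, 0 < D i) (i : σ) {p : MvPolynomial σ K}
    (hp : p ∈ LinearMap.range (substPow D h)) : h i * p ∈ LinearMap.range (substPow D h) := by
  obtain ⟨q, rfl⟩ := hp
  exact ⟨_, (mul_substPow hD i q).symm⟩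

theorem homogeneousComponent_mul_mem_range_substPow (hD : ∀ i, 0 < D i)
    (hh : ∀ i, (h i).IsHomogeneous (D i)) {n : ℕ}
    (ih : ∀ m < n, ∀ p, homogeneousComponent m p ∈ LinearMap.range (substPow D h)) (i : σ)
    (p : MvPolynomial σ K) :
    homogeneousComponent n (h i * p) ∈ LinearMap.range (substPow D h) := by
  rw [← sum_homogeneousComponent p, Finset.mul_sum, map_sum]
  refine Submodule.sum_mem _ fun j _ => ?_
  rw [homogeneousComponent_of_mem ((hh i).mul (homogeneousComponent_isHomogeneous j p))]
  split_ifs with hj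
  · exact mul_mem_range_substPow hD i (ih j (by have := hD i; omega) p)
  · exact Submodule.zero_mem _

theorem substPow_surjective (hD : ∀ i, 0 < D i) (hh : ∀ i, (h i).IsHomogeneous (D i))
    (m : MonomialOrder σ) {G : σ → MvPolynomial σ K} (hG : ∀ i, G i ∈ Ideal.span (Set.range h))
    (hGm : ∀ i, m.Monic (G i)) (hGd : ∀ i, m.degree (G i) = Finsupp.single i (D i)) :
    Function.Surjective (substPow D h) := by
  have key : ∀ n p, homogeneousComponent n p ∈ LinearMap.range (substPow D h) := by
    intro n
    induction n using Nat.strong_induction_on with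
    | _ n ih =>
    intro p
    obtain ⟨g, r, hp, -, hr⟩ :=
      m.div (b := G) (fun i => by rw [(hGm i).leadingCoeff_eq_one]; exact isUnit_one) p
    rw [hp, map_add]
    refine Submodule.add_mem _ ?_ ?_
    · have hmem : Finsupp.linearCombination _ G g ∈ Ideal.span (Set.range h) := by
        rw [Finsupp.linearCombination_apply]
        exact Submodule.sum_mem _ fun i _ => Ideal.mul_mem_left _ _ (hG i)
      obtain ⟨c, hc⟩ := (Submodule.mem_span_range_iff_exists_fun _).1 hmem
      rw [← hc, map_sum]
      refine Submodule.sum_mem _ fun i _ => ?_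
      rw [smul_eq_mul, mul_comm]
      exact homogeneousComponent_mul_mem_range_substPow hD hh ih i _
    · refine ⟨homogeneousComponent n r, ?_⟩
      rw [← homogeneousComponent_substPow hh]
      congr 1
      conv_rhs => rw [r.as_sum]
      conv_lhs => rw [r.as_sum]
      rw [map_sum]
      refine Finset.sum_congr rfl fun c hc => ?_
      have : monomial c (coeff c r) = coeff c r • monomial c (1 : K) := by
        rw [smul_monomial, smul_eq_mul, mul_one]
      rw [this, map_smul, substPow_monomial_of_lt]
      intro i
      have := hr c hc i
      rw [hGd, Finsupp.single_le_iff] at this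
      omega
  intro p
  rw [← LinearMap.mem_range, ← sum_homogeneousComponent p]
  exact Submodule.sum_mem _ fun n _ => key n p

theorem substPow_injective_of_surjective (hh : ∀ i, (h i).IsHomogeneous (D i))
    (hs : Function.Surjective (substPow D h)) : Function.Injective (substPow D h) := by
  have hmem : ∀ n, ∀ p ∈ homogeneousSubmodule σ K n,
      substPow D h p ∈ homogeneousSubmodule σ K n := by
    intro n p hp
    rw [← homogeneousComponent_eq_self hp, ← homogeneousComponent_substPow hh]
    exact homogeneousComponent_mem _ _
  have hinj : ∀ n, Function.Injective ((substPow D h).restrict (hmem n)) := by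
    intro n
    have : Module.Finite K (homogeneousSubmodule σ K n) :=
      Module.Finite.iff_fg.2 (homogeneousSubmodule_fg σ K n)
    refine LinearMap.injective_iff_surjective.2 fun q => ?_
    obtain ⟨p, hp⟩ := hs q
    refine ⟨⟨homogeneousComponent n p, homogeneousComponent_mem _ _⟩, Subtype.ext ?_⟩
    rw [LinearMap.coe_restrict_apply, ← homogeneousComponent_substPow hh, hp]
    exact homogeneousComponent_eq_self q.2
  refine (injective_iff_map_eq_zero _).2 fun p hp => ?_
  rw [← sum_homogeneousComponent p]
  refine Finset.sum_eq_zero fun n _ => ?_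
  have := (injective_iff_map_eq_zero _).1 (hinj n)
    ⟨homogeneousComponent n p, homogeneousComponent_mem _ _⟩ (Subtype.ext ?_)
  · exact congrArg Subtype.val this
  · rw [LinearMap.coe_restrict_apply, ← homogeneousComponent_substPow hh, hp, map_zero]
    rfl

theorem aeval_faithfullyFlat (hD : ∀ i, 0 < D i) (hh : ∀ i, (h i).IsHomogeneous (D i))
    (m : MonomialOrder σ) {G : σ → MvPolynomial σ K} (hG : ∀ i, G i ∈ Ideal.span (Set.range h))
    (hGm : ∀ i, m.Monic (G i)) (hGd : ∀ i, m.degree (G i) = Finsupp.single i (D i)) :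
    (aeval h : MvPolynomial σ K →ₐ[K] MvPolynomial σ K).toRingHom.FaithfullyFlat := by
  have hs := substPow_surjective hD hh m hG hGm hGd
  have : ∀ i, NeZero (D i) := fun i => ⟨(hD i).ne'⟩
  let γ := ((basisMonomials σ K).map (LinearEquiv.ofBijective (substPow D h)
    ⟨substPow_injective_of_surjective hh hs, hs⟩)).reindex (exponentDivMod D)
  let alg := (aeval h : MvPolynomial σ K →ₐ[K] MvPolynomial σ K).toRingHom.toAlgebra
  have tower : @IsScalarTower K (MvPolynomial σ K) (MvPolynomial σ K) _ alg.toSMul _ := by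
    refine @IsScalarTower.of_algebraMap_eq _ _ _ _ _ _ _ alg _ fun x => ?_
    exact ((aeval h : MvPolynomial σ K →ₐ[K] MvPolynomial σ K).commutes x).symm
  have free := @Module.Free.of_basis_smul K (MvPolynomial σ K) (MvPolynomial σ K) _ _ _ _ _ _ _ alg
    tower (basisMonomials σ K) (fun a : ∀ i, Fin (D i) => ∏ i, X i ^ (a i : ℕ)) γ ?_
  · rw [RingHom.FaithfullyFlat]
    exact @Module.FaithfullyFlat.instOfNontrivialOfFree _ _ _ _ alg.toModule _ free
  · intro p
    have hγ : γ p = ∏ i, h i ^ p.2 i * X i ^ (p.1 i : ℕ) := by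
      have hp : γ p = substPow D h (monomial ((exponentDivMod D).symm p) 1) := by
        simp only [γ, Module.Basis.reindex_apply, Module.Basis.map_apply, coe_basisMonomials]
        rfl
      rw [hp, substPow_monomial]
      refine Finset.prod_congr rfl fun i _ => ?_
      simp [exponentDivMod, Nat.add_mul_div_left _ _ (hD i), Nat.div_eq_of_lt (p.1 i).2,
        Nat.mod_eq_of_lt (p.1 i).2]
    have hβ : aeval h (basisMonomials σ K p.2) = ∏ i, h i ^ p.2 i := by
      rw [coe_basisMonomials, aeval_monomial, map_one, one_mul, Finsupp.prod_fintype _ _ (by simp)]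
    rw [hγ, Finset.prod_mul_distrib, ← hβ]
    rfl

end MvPolynomial

open TensorProduct in
theorem RingHom.Flat.of_comp_faithfullyFlat {R S T : Type*} [CommRing R] [CommRing S]
    [CommRing T] {f : R →+* S} {g : S →+* T} (hgf : (g.comp f).Flat) (hg : g.FaithfullyFlat) :
    f.Flat := by
  algebraize [f, g, g.comp f]
  change Module.Flat R S
  have : Module.Flat R T := hgf
  have : Module.FaithfullyFlat S T := hg
  refine Module.Flat.iff_lTensor_preserves_injective_linearMap.2 fun M N _ _ _ _ φ hφ => ?_
  have := Module.Flat.lTensor_preserves_injective_linearMap (M := T) φ hφ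
  have h : Function.Injective ((AlgebraTensorModule.lTensor S S φ).lTensor T) := by
    have hc := congrArg DFunLike.coe
      (AlgebraTensorModule.lTensor_comp_cancelBaseChange R S S (M := T) φ)
    rw [LinearMap.coe_comp, LinearMap.coe_comp] at hc
    refine Function.Injective.of_comp (f := AlgebraTensorModule.cancelBaseChange R S S T N) ?_
    exact hc ▸ this.comp (LinearEquiv.injective _)
  exact (Module.FaithfullyFlat.lTensor_injective_iff_injective S T _).1 h

section CommRing

variable {S : Type*} [CommRing S]

/-- The coefficients of `(1 + a₀ F) (1 + a₁ F) ⋯ (1 + a_{r-1} F)` in the twisted polynomial ring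
in which `F * s = s ^ 2 * F`. -/
def twistedProd (a : ℕ → S) : ℕ → ℕ → S
  | 0, 0 => 1
  | 0, _ + 1 => 0
  | _ + 1, 0 => 1
  | r + 1, n + 1 => twistedProd a r (n + 1) + twistedProd a r n * a r ^ 2 ^ n

/-- The coefficients of the inverse of `(1 + a₀ F) (1 + a₁ F) ⋯ (1 + a_{r-1} F)` in the twisted
power series ring of characteristic two in which `F * s = s ^ 2 * F`. -/
def twistedInv (a : ℕ → S) : ℕ → ℕ → S
  | 0, 0 => 1
  | 0, _ + 1 => 0
  | _ + 1, 0 => 1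
  | r + 1, n + 1 => twistedInv a r (n + 1) + a r * twistedInv a (r + 1) n ^ 2

variable (a : ℕ → S)

@[simp] theorem twistedProd_zero_right (r : ℕ) : twistedProd a r 0 = 1 := by
  cases r <;> simp [twistedProd]

@[simp] theorem twistedInv_zero_right (r : ℕ) : twistedInv a r 0 = 1 := by
  cases r <;> simp [twistedInv]

theorem twistedProd_succ (r n : ℕ) :
    twistedProd a (r + 1) (n + 1) = twistedProd a r (n + 1) + twistedProd a r n * a r ^ 2 ^ n := by
  rw [twistedProd]

theorem twistedInv_succ (r n : ℕ) :
    twistedInv a (r + 1) (n + 1) = twistedInv a r (n + 1) + a r * twistedInv a (r + 1) n ^ 2 := by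
  rw [twistedInv]

theorem twistedProd_eq_zero {r n : ℕ} (h : r < n) : twistedProd a r n = 0 := by
  induction r generalizing n with
  | zero => obtain ⟨n, rfl⟩ := Nat.exists_eq_succ_of_ne_zero h.ne'; simp [twistedProd]
  | succ r ih =>
    obtain ⟨n, rfl⟩ := Nat.exists_eq_succ_of_ne_zero (Nat.ne_zero_of_lt h)
    rw [Nat.succ_eq_add_one, twistedProd_succ, ih (by omega), ih (by omega)]
    simp

theorem twistedInv_mem {k m : ℕ} {I : Ideal S}
    (hI : ∀ i < k, twistedInv a k (m + 1 + i) ∈ I) {r n : ℕ} (hr : r ≤ k) (hn : m + 1 + (k - r) ≤ n)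
    (hn' : n ≤ m + k) : twistedInv a r n ∈ I := by
  induction hr using Nat.decreasingInduction generalizing n with
  | self =>
    obtain ⟨i, rfl⟩ := Nat.exists_eq_add_of_le (show m + 1 ≤ n by omega)
    exact hI i (by omega)
  | of_succ r hr ih =>
    obtain ⟨n, rfl⟩ := Nat.exists_eq_succ_of_ne_zero (show n ≠ 0 by omega)
    have : twistedInv a r (n + 1) =
        twistedInv a (r + 1) (n + 1) - a r * twistedInv a (r + 1) n ^ 2 := by
      rw [twistedInv_succ, add_sub_cancel_right]
    rw [Nat.succ_eq_add_one, this]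
    exact I.sub_mem (ih (by omega) (by omega))
      (I.mul_mem_left _ (I.pow_mem_of_mem (ih (by omega) (by omega)) 2 two_pos))

variable [CharP S 2]

open Finset in
theorem sum_twistedProd_pow_mul_twistedInv (r n : ℕ) :
    ∑ p ∈ antidiagonal (n + 1), twistedProd a r p.1 ^ 2 ^ p.2 * twistedInv a r p.2 = 0 := by
  induction r generalizing n with
  | zero =>
    refine sum_eq_zero fun p hp => ?_
    obtain ⟨i, l⟩ := p
    rw [HasAntidiagonal.mem_antidiagonal] at hp
    rcases i with _ | i
    · obtain rfl : l = n + 1 := by simpa using hp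
      simp [twistedInv]
    · simp [twistedProd]
  | succ r ih =>
    have hD : ∀ n, ∑ p ∈ antidiagonal n, twistedProd a r p.1 ^ 2 ^ p.2 * twistedInv a (r + 1) p.2 =
        a r ^ (2 ^ n - 1) := by
      intro n
      induction n with
      | zero => simp
      | succ n ihn =>
        have h := ih n
        rw [Nat.sum_antidiagonal_succ'] at h ⊢
        simp only [twistedInv_succ, mul_add, sum_add_distrib, twistedInv_zero_right] at h ⊢
        rw [← add_assoc, h, zero_add]
        have : ∀ p ∈ antidiagonal n,
            twistedProd a r p.1 ^ 2 ^ (p.2 + 1) * (a r * twistedInv a (r + 1) p.2 ^ 2) =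
            a r * (twistedProd a r p.1 ^ 2 ^ p.2 * twistedInv a (r + 1) p.2) ^ 2 := by
          intro p _
          ring
        rw [sum_congr rfl this, ← mul_sum, ← CharTwo.sum_sq, ihn, ← pow_mul, ← pow_succ']
        congr 1
        have := Nat.one_le_two_pow (n := n)
        omega
    have h := hD (n + 1)
    rw [Nat.sum_antidiagonal_succ] at h ⊢
    have : ∀ p ∈ antidiagonal n,
        twistedProd a (r + 1) (p.1 + 1) ^ 2 ^ p.2 * twistedInv a (r + 1) p.2 =
        twistedProd a r (p.1 + 1) ^ 2 ^ p.2 * twistedInv a (r + 1) p.2 +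
        a r ^ 2 ^ n * (twistedProd a r p.1 ^ 2 ^ p.2 * twistedInv a (r + 1) p.2) := by
      intro p hp
      rw [← HasAntidiagonal.mem_antidiagonal.1 hp, twistedProd_succ, add_pow_char_pow, mul_pow, ← pow_mul,
        ← pow_add]
      ring
    rw [sum_congr rfl this, sum_add_distrib, ← mul_sum, hD n, ← add_assoc]
    simp only [twistedProd_zero_right] at h ⊢
    rw [h, ← pow_add]
    have e : 2 ^ n + (2 ^ n - 1) = 2 ^ (n + 1) - 1 := by
      have := Nat.one_le_two_pow (n := n)
      omega
    rw [e, CharTwo.add_self_eq_zero]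

theorem twistedInv_eq_sum (r n : ℕ) :
    twistedInv a r (n + 1) =
      ∑ i ∈ Finset.range (n + 1), twistedProd a r (i + 1) ^ 2 ^ (n - i) * twistedInv a r (n - i) := by
  have h := sum_twistedProd_pow_mul_twistedInv a r n
  rw [Finset.Nat.sum_antidiagonal_succ, Finset.Nat.sum_antidiagonal_eq_sum_range_succ_mk,
    CharTwo.add_eq_zero] at h
  simpa using h

end CommRing

namespace MvPolynomial

variable {K : Type*} [Field K]

/-- The variables of `K[X₀, …, X_{k-1}]` in decreasing order of the index, continued by zero. -/
noncomputable def revX (K : Type*) [Field K] (k r : ℕ) : MvPolynomial (Fin k) K :=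
  if h : r < k then X (Fin.rev ⟨r, h⟩) else 0

theorem isHomogeneous_revX (k r : ℕ) : (revX K k r).IsHomogeneous 1 := by
  unfold revX
  split_ifs
  exacts [isHomogeneous_X _ _, isHomogeneous_zero _ _ _]

theorem isHomogeneous_twistedProd (k r n : ℕ) :
    (twistedProd (revX K k) r n).IsHomogeneous (2 ^ n - 1) := by
  induction r generalizing n with
  | zero => cases n <;> simp [twistedProd, isHomogeneous_one, isHomogeneous_zero]
  | succ r ih =>
    cases n with
    | zero => simpa using isHomogeneous_one _ _
    | succ n =>
      rw [twistedProd_succ]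
      refine (ih _).add ?_
      convert (ih n).mul ((isHomogeneous_revX k r).pow (2 ^ n)) using 1
      have := Nat.one_le_two_pow (n := n)
      omega

theorem isHomogeneous_twistedInv (k r n : ℕ) :
    (twistedInv (revX K k) r n).IsHomogeneous (2 ^ n - 1) := by
  induction r generalizing n with
  | zero => cases n <;> simp [twistedInv, isHomogeneous_one, isHomogeneous_zero]
  | succ r ihr =>
    induction n with
    | zero => simpa using isHomogeneous_one _ _
    | succ n ihn =>
      rw [twistedInv_succ]
      refine (ihr _).add ?_
      convert (isHomogeneous_revX k r).mul (ihn.pow 2) using 1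
      have := Nat.one_le_two_pow (n := n)
      omega

theorem _root_.MonomialOrder.lex_single_lt_single {σ : Type*} [LinearOrder σ] [WellFoundedGT σ]
    {i j : σ} (hij : i < j) {c d : ℕ} (hd : 0 < d) :
    MonomialOrder.lex.toSyn (Finsupp.single j c) < MonomialOrder.lex.toSyn (Finsupp.single i d) := by
  rw [MonomialOrder.lex_lt_iff, Finsupp.Lex.lt_iff]
  refine ⟨i, fun l hl => ?_, ?_⟩
  · simp [Finsupp.single_eq_of_ne hl.ne, Finsupp.single_eq_of_ne (hl.trans hij).ne]
  · simpa [Finsupp.single_eq_of_ne hij.ne] using hd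

theorem monic_twistedInv (k r n : ℕ) (hr : r < k) :
    MonomialOrder.lex.Monic (twistedInv (revX K k) (r + 1) n) ∧
      MonomialOrder.lex.degree (twistedInv (revX K k) (r + 1) n) =
        Finsupp.single (Fin.rev ⟨r, hr⟩) (2 ^ n - 1) := by
  have hlt : ∀ n, MonomialOrder.lex.toSyn
      (MonomialOrder.lex.degree (twistedInv (revX K k) r (n + 1))) <
        MonomialOrder.lex.toSyn (Finsupp.single (Fin.rev ⟨r, hr⟩) (2 ^ (n + 1) - 1)) := by
    intro n
    have hpos : 0 < 2 ^ (n + 1) - 1 := by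
      have := Nat.one_lt_two_pow n.succ_ne_zero
      omega
    cases r with
    | zero =>
      rw [twistedInv, MonomialOrder.degree_zero, map_zero, MonomialOrder.toSyn_lt_iff_ne_zero]
      exact Finsupp.single_ne_zero.2 hpos.ne'
    | succ r =>
      rw [(monic_twistedInv k r (n + 1) (by omega)).2]
      refine MonomialOrder.lex_single_lt_single ?_ hpos
      simp
  induction n with
  | zero => simp
  | succ n ih =>
    have hX : revX K k r = X (Fin.rev ⟨r, hr⟩) := dif_pos hr
    have hmon : MonomialOrder.lex.Monic (revX K k r * twistedInv (revX K k) (r + 1) n ^ 2) := by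
      rw [hX]
      exact MonomialOrder.monic_X.mul ih.1.pow
    have hdeg : MonomialOrder.lex.degree (revX K k r * twistedInv (revX K k) (r + 1) n ^ 2) =
        Finsupp.single (Fin.rev ⟨r, hr⟩) (2 ^ (n + 1) - 1) := by
      rw [MonomialOrder.degree_mul' hmon.ne_zero, MonomialOrder.degree_pow, ih.2, hX,
        MonomialOrder.degree_X, Finsupp.smul_single, ← Finsupp.single_add]
      congr 1
      have := Nat.one_le_two_pow (n := n)
      rw [smul_eq_mul]
      omega
    have h := hlt n
    rw [← hdeg] at h
    rw [twistedInv_succ, add_comm]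
    exact ⟨hmon.add_of_lt h, (MonomialOrder.degree_add_of_lt h).trans hdeg⟩

theorem aeval_faithfullyFlat_of_twistedInv_mem [CharP K 2] {k m : ℕ}
    {h : Fin k → MvPolynomial (Fin k) K} (hh : ∀ i, (h i).IsHomogeneous (2 ^ (m + 1 + i) - 1))
    (hI : ∀ i < k, twistedInv (revX K k) k (m + 1 + i) ∈ Ideal.span (Set.range h)) :
    (aeval h : MvPolynomial (Fin k) K →ₐ[K] MvPolynomial (Fin k) K).toRingHom.FaithfullyFlat := by
  have hG : ∀ i : Fin k, MonomialOrder.lex.Monic (twistedInv (revX K k) (k - i) (m + 1 + i)) ∧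
      MonomialOrder.lex.degree (twistedInv (revX K k) (k - i) (m + 1 + i)) =
        Finsupp.single i (2 ^ (m + 1 + i) - 1) := by
    intro i
    have := monic_twistedInv (K := K) k (Fin.rev i) (m + 1 + i) (Fin.rev i).2
    rw [Fin.eta, Fin.rev_rev, Fin.val_rev] at this
    rwa [show k - (i + 1 : ℕ) + 1 = k - i by omega] at this
  refine aeval_faithfullyFlat (fun i => ?_) hh MonomialOrder.lex (fun i => ?_)
    (fun i => (hG i).1) (fun i => (hG i).2)
  · have := Nat.one_lt_two_pow (show m + 1 + i.1 ≠ 0 by omega)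
    omega
  · exact twistedInv_mem _ hI (by omega) (by omega) (by omega)

end MvPolynomial

/-- The map `A⟨k⟩ → F₂[a₁, …, a_k]` induced by the factorization
`1 + ξ₁ F + ⋯ + ξ_k F ^ k = (1 + a₁ F) ⋯ (1 + a_k F)`. -/
noncomputable def splitting (k : ℕ) :
    MvPolynomial (Fin k) (ZMod 2) →ₐ[ZMod 2] MvPolynomial (Fin k) (ZMod 2) :=
  aeval fun i => twistedProd (revX (ZMod 2) k) k (i + 1)

theorem splitting_proj_X (k i : ℕ) :
    splitting k (proj k (X i)) = twistedProd (revX (ZMod 2) k) k (i + 1) := by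
  rw [proj, aeval_X]
  split_ifs with h
  · simp [splitting]
  · rw [map_zero, twistedProd_eq_zero _ (by omega)]

theorem splitting_zetaBar (k n : ℕ) :
    splitting k (zetaBar k n) = twistedInv (revX (ZMod 2) k) k n := by
  induction n using Nat.strong_induction_on with
  | _ n ih =>
    cases n with
    | zero => simp [zetaBar, zeta]
    | succ n =>
      rw [zetaBar, zeta, twistedInv_eq_sum, map_sum, map_sum]
      refine Finset.sum_congr rfl fun i hi => ?_
      rw [map_mul, map_mul, map_pow, map_pow, splitting_proj_X, ← ih (n - i) (by omega), zetaBar]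

theorem splitting_faithfullyFlat (k : ℕ) : (splitting k).toRingHom.FaithfullyFlat := by
  refine aeval_faithfullyFlat_of_twistedInv_mem (m := 0) (fun i => ?_) fun n _ => ?_
  · rw [zero_add, add_comm]
    exact isHomogeneous_twistedProd _ _ _
  · rw [zero_add, add_comm, twistedInv_eq_sum]
    refine Ideal.sum_mem _ fun i _ => Ideal.mul_mem_right _ _ (Ideal.pow_mem_of_mem _ ?_ _ ?_)
    · by_cases hi : i < k
      · exact Ideal.subset_span ⟨⟨i, hi⟩, rfl⟩
      · rw [twistedProd_eq_zero _ (by omega)]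
        exact Ideal.zero_mem _
    · positivity

/-- STATEMENT 5: For `k ≥ 1` and `m ≥ 0`, `A⟨k⟩` is flat as a module over
`F₂[y₁, …, y_k]`, acting through the algebra map `y_i ↦ ζ̄_{m+i}`. -/
theorem flat_over_zetaBar_polynomials (k m : ℕ) (hk : 1 ≤ k) :
    ((MvPolynomial.aeval fun i : Fin k => zetaBar k (m + 1 + (i : ℕ)) :
        MvPolynomial (Fin k) (ZMod 2) →ₐ[ZMod 2]
          MvPolynomial (Fin k) (ZMod 2)).toRingHom).Flat := by
  refine RingHom.Flat.of_comp_faithfullyFlat ?_ (splitting_faithfullyFlat k)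
  have hcomp : (splitting k).comp (aeval fun i : Fin k => zetaBar k (m + 1 + (i : ℕ))) =
      aeval fun i : Fin k => twistedInv (revX (ZMod 2) k) k (m + 1 + i) := by
    ext1 i
    simp [splitting_zetaBar]
  have h := aeval_faithfullyFlat_of_twistedInv_mem (K := ZMod 2) (k := k) (m := m)
    (h := fun i => twistedInv (revX (ZMod 2) k) k (m + 1 + i))
    (fun i => isHomogeneous_twistedInv _ _ _) fun i hi => Ideal.subset_span ⟨⟨i, hi⟩, rfl⟩
  rw [← hcomp] at h
  exact h.flat
end

section
/- Let k ≥ 1 and m ≥ 0. The quotient A⟨k⟩/(ζ̄_{m+1}, …, ζ̄_{m+k}) is a finite-dimensional F₂-vector space whose dimension d satisfies d · ∏_{i=1}^{k} (2^i − 1) = ∏_{i=1}^{k} (2^{m+i} − 1); that is, d equals the Gaussian binomial coefficient (m+k choose k)_q evaluated at q = 2. -/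
open MvPolynomial

section FrobeniusInverse

variable {S : Type*} [CommRing S]

/-- The coefficients of the product `(∑ z_j F^j) (∑ x_i F^i)` of twisted power series, where
`F` is the squaring operator. -/
def twistedConv (z x : ℕ → S) (n : ℕ) : S :=
  ∑ j ∈ Finset.range (n + 1), z j * x (n - j) ^ 2 ^ j

theorem eq_of_twistedConv_eq {x z z' : ℕ → S} (hx : x 0 = 1)
    (h : ∀ n, twistedConv z x n = twistedConv z' x n) (n : ℕ) : z n = z' n := by
  induction n using Nat.strong_induction_on with
  | _ n ih =>
    have hn := h n
    rw [twistedConv, twistedConv, Finset.sum_range_succ, Finset.sum_range_succ,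
      Finset.sum_congr rfl fun j hj => by rw [ih j (Finset.mem_range.1 hj)]] at hn
    simpa [hx] using hn

variable [CharP S 2]

/-- If `x = y (1 + aF)` and `w` is the left inverse of `y`, then the left inverse `z` of `x`
satisfies `(1 + aF) z = w`. -/
theorem leftInverse_succ {x y z w : ℕ → S} {a : S} (hx : x 0 = 1) (hy : y 0 = 1)
    (hxy : ∀ n, x (n + 1) = y (n + 1) + y n * a ^ 2 ^ n)
    (hz : ∀ n, twistedConv z x n = if n = 0 then 1 else 0)
    (hw : ∀ n, twistedConv w y n = if n = 0 then 1 else 0) (n : ℕ) :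
    z (n + 1) = a * z n ^ 2 + w (n + 1) := by
  let u : ℕ → S := fun n => Nat.rec 1 (fun n un => a * un ^ 2 + w (n + 1)) n
  have hu0 : u 0 = 1 := rfl
  have husucc : ∀ n, u (n + 1) = a * u n ^ 2 + w (n + 1) := fun n => rfl
  have hw0 : w 0 = 1 := by simpa [twistedConv, hy] using hw 0
  have hT : ∀ n, twistedConv w x (n + 1) = a ^ 2 ^ n * twistedConv w y n := by
    intro n
    have h1 : twistedConv w x (n + 1) =
        twistedConv w y (n + 1) + a ^ 2 ^ n * twistedConv w y n := by
      simp only [twistedConv]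
      rw [Finset.sum_range_succ, Finset.sum_range_succ _ (n + 1), Finset.mul_sum,
        add_right_comm, ← Finset.sum_add_distrib]
      congr 1
      · refine Finset.sum_congr rfl fun j hj => ?_
        have hj' : j ≤ n := Nat.lt_succ_iff.1 (Finset.mem_range.1 hj)
        rw [Nat.succ_sub hj', Nat.succ_eq_add_one, hxy, add_pow_char_pow, mul_pow, ← pow_mul,
          ← pow_add, Nat.sub_add_cancel hj']
        ring
      · simp [hx, hy]
    rw [h1, hw (n + 1)]
    simp
  have hS : ∀ n, twistedConv u x (n + 1) =
      twistedConv w x (n + 1) + a * twistedConv u x n ^ 2 := by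
    intro n
    simp only [twistedConv]
    rw [Finset.sum_range_succ', Finset.sum_range_succ' _ (n + 1), sum_pow_char, Finset.mul_sum,
      add_right_comm, ← Finset.sum_add_distrib]
    congr 1
    · refine Finset.sum_congr rfl fun j hj => ?_
      rw [husucc, Nat.add_sub_add_right]
      ring
    · simp [hu0, hw0]
  have hu : ∀ n, twistedConv u x n = if n = 0 then 1 else 0 := by
    intro n
    induction n with
    | zero => simp [twistedConv, hu0, hx]
    | succ n ih =>
      rw [hS, hT, ih, hw]
      rcases eq_or_ne n 0 with rfl | hn
      · simp [CharTwo.add_self_eq_zero]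
      · simp [hn]
  have hzu := eq_of_twistedConv_eq hx fun n => (hz n).trans (hu n).symm
  rw [hzu, hzu, husucc]

end FrobeniusInverse

section MonicQuotient

open Polynomial

/-- For monic `p`, the quotient of `R[X]` by `I` and `p` is free over `R ⧸ I` on `p.natDegree`
generators. -/
theorem nonempty_quotient_map_C_sup_span_equiv {F R : Type*} [Field F] [CommRing R] [Algebra F R]
    (I : Ideal R) {p : R[X]} (hp : p.Monic) :
    Nonempty ((R[X] ⧸ (I.map (C : R →+* R[X]) ⊔ Ideal.span {p})) ≃ₗ[F]
      (Fin p.natDegree → R ⧸ I)) := by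
  rcases subsingleton_or_nontrivial (R ⧸ I) with hs | hs
  · have hI : I = ⊤ := Ideal.Quotient.subsingleton_iff.1 hs
    have : Subsingleton (R[X] ⧸ (I.map (C : R →+* R[X]) ⊔ Ideal.span {p})) := by
      rw [Ideal.Quotient.subsingleton_iff, hI, Ideal.map_top, top_sup_eq]
    exact ⟨0, 0, fun _ => Subsingleton.elim _ _, fun _ => Subsingleton.elim _ _⟩
  · let q : (R ⧸ I)[X] := p.map (Ideal.Quotient.mk I)
    have hq : q.Monic := hp.map _
    let π : R[X] →ₐ[F] (R ⧸ I)[X] := Polynomial.mapAlgHom (Ideal.Quotient.mkₐ F I)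
    have hπ : Function.Surjective π := Polynomial.map_surjective _ Ideal.Quotient.mk_surjective
    let φ : R[X] →ₐ[F] ((R ⧸ I)[X] ⧸ Ideal.span {q}) := (Ideal.Quotient.mkₐ F _).comp π
    have hφ : Function.Surjective φ := (Ideal.Quotient.mkₐ_surjective F _).comp hπ
    have hker : RingHom.ker φ = I.map (C : R →+* R[X]) ⊔ Ideal.span {p} := by
      have h1 : RingHom.ker φ = (Ideal.span {q}).comap π := by
        ext r
        simp [φ, RingHom.mem_ker, Ideal.Quotient.eq_zero_iff_mem]
      have h2 : Ideal.span {q} = (Ideal.span {p}).map π := by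
        rw [Ideal.map_span, Set.image_singleton]
        rfl
      have h3 : Ideal.comap π ⊥ = I.map (C : R →+* R[X]) := by
        have := Polynomial.ker_mapRingHom (Ideal.Quotient.mk I)
        rw [Ideal.mk_ker] at this
        rw [← this]
        rfl
      rw [h1, h2, Ideal.comap_map_of_surjective π hπ, h3, sup_comm]
    let e₁ := (Ideal.quotientEquivAlgOfEq F hker.symm).trans
      (Ideal.quotientKerAlgEquivOfSurjective hφ)
    let b := (AdjoinRoot.powerBasis' hq).basis
    have hdim : (AdjoinRoot.powerBasis' hq).dim = p.natDegree := by
      rw [AdjoinRoot.powerBasis'_dim, hp.natDegree_map]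
    let e₂ : ((R ⧸ I)[X] ⧸ Ideal.span {q}) ≃ₗ[R ⧸ I] (Fin p.natDegree → R ⧸ I) :=
      (b.reindex (finCongr hdim)).equivFun
    exact ⟨e₁.toLinearEquiv.trans (e₂.restrictScalars F)⟩

end MonicQuotient

/-- The sequence `1, ξ₁, …, ξ_k, 0, 0, …` in `A⟨k⟩`. -/
noncomputable def xiBar (k : ℕ) : ℕ → MvPolynomial (Fin k) (ZMod 2)
  | 0 => 1
  | n + 1 => if h : n < k then X ⟨n, h⟩ else 0

theorem twistedConv_zetaBar_xiBar (k n : ℕ) :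
    twistedConv (zetaBar k) (xiBar k) n = if n = 0 then 1 else 0 := by
  have h0 : zetaBar k 0 = 1 := by simp [zetaBar, zeta]
  cases n with
  | zero => simp [twistedConv, h0, xiBar]
  | succ n =>
    have h : zetaBar k (n + 1) =
        ∑ j ∈ Finset.range (n + 1), zetaBar k j * xiBar k (n + 1 - j) ^ 2 ^ j := by
      rw [← Finset.sum_range_reflect, zetaBar, zeta, map_sum]
      refine Finset.sum_congr rfl fun i hi => ?_
      have hi' : i ≤ n := Nat.lt_succ_iff.1 (Finset.mem_range.1 hi)
      have h1 : n + 1 - 1 - i = n - i := by omega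
      have h2 : n + 1 - (n - i) = i + 1 := by omega
      rw [h1, h2, map_mul, map_pow, mul_comm]
      simp [proj, xiBar, zetaBar]
    rw [twistedConv, Finset.sum_range_succ, ← h]
    simp [xiBar, CharTwo.add_self_eq_zero]

theorem twistedConv_map {R S : Type*} [CommRing R] [CommRing S] (f : R →+* S) (z x : ℕ → R)
    (n : ℕ) :
    twistedConv (fun i => f (z i)) (fun i => f (x i)) n = f (twistedConv z x n) := by
  simp [twistedConv]

/-- Right multiplication of `1 + ξ₁F + … + ξ_kF^k` by `1 + aF`, where `a` is the polynomial
variable, as an algebra map `A⟨k+1⟩[a] → A⟨k⟩[a]`. -/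
noncomputable def appendFactor (k : ℕ) :
    Polynomial (MvPolynomial (Fin (k + 1)) (ZMod 2)) →ₐ[ZMod 2]
      Polynomial (MvPolynomial (Fin k) (ZMod 2)) :=
  Polynomial.eval₂AlgHom
    (aeval fun i : Fin (k + 1) => Polynomial.C (xiBar k (i + 1)) +
      Polynomial.C (xiBar k i) * Polynomial.X ^ 2 ^ (i : ℕ))
    Polynomial.X fun _ => Commute.all _ _

theorem appendFactor_X (k : ℕ) : appendFactor k Polynomial.X = Polynomial.X := by
  simp [appendFactor]

theorem appendFactor_xiBar_succ (k n : ℕ) :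
    appendFactor k (Polynomial.C (xiBar (k + 1) (n + 1))) =
      Polynomial.C (xiBar k (n + 1)) +
        Polynomial.C (xiBar k n) * Polynomial.X ^ 2 ^ n := by
  by_cases h : n < k + 1
  · rw [xiBar, dif_pos h]
    simp [appendFactor]
  · obtain ⟨l, rfl⟩ : ∃ l, n = l + 1 := ⟨n - 1, by omega⟩
    have h1 : ¬ l + 1 < k := by omega
    have h2 : ¬ l < k := by omega
    simp [xiBar, h, h1, h2]

/-- The coefficients of `(1 + ξ₁F + … + ξ_kF^k) (1 + aF)⁻¹`. -/
noncomputable def divFactor (k : ℕ) : ℕ → Polynomial (MvPolynomial (Fin k) (ZMod 2))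
  | 0 => 1
  | n + 1 => divFactor k n * Polynomial.X ^ 2 ^ n + Polynomial.C (xiBar k (n + 1))

theorem appendFactor_divFactor (k n : ℕ) :
    appendFactor k (divFactor (k + 1) n) = Polynomial.C (xiBar k n) := by
  induction n with
  | zero => simp [divFactor, xiBar]
  | succ n ih =>
    rw [divFactor, map_add, map_mul, map_pow, appendFactor_X, ih, appendFactor_xiBar_succ,
      add_comm, add_assoc, CharTwo.add_self_eq_zero, add_zero]

theorem monic_add_C_of_natDegree_pos {R : Type*} [CommRing R] [Nontrivial R] {p : Polynomial R}
    (hp : p.Monic) (hd : 0 < p.natDegree) (c : R) :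
    (p + Polynomial.C c).Monic :=
  hp.add_of_left
    (Polynomial.degree_C_le.trans_lt (Polynomial.natDegree_pos_iff_degree_pos.1 hd))

theorem divFactor_monic (k n : ℕ) :
    (divFactor k n).Monic ∧ (divFactor k n).natDegree + 1 = 2 ^ n := by
  induction n with
  | zero => simp [divFactor]
  | succ n ih =>
    have hm : (divFactor k n * Polynomial.X ^ 2 ^ n).Monic :=
      ih.1.mul (Polynomial.monic_X_pow _)
    have hd : (divFactor k n * Polynomial.X ^ 2 ^ n).natDegree + 1 = 2 ^ (n + 1) := by
      rw [ih.1.natDegree_mul (Polynomial.monic_X_pow _), Polynomial.natDegree_X_pow, pow_succ]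
      omega
    have hpos : 0 < 2 ^ n := Nat.two_pow_pos n
    rw [divFactor, Polynomial.natDegree_add_C]
    exact ⟨monic_add_C_of_natDegree_pos hm (by rw [pow_succ] at hd; omega) _, hd⟩

theorem appendFactor_surjective (k : ℕ) : Function.Surjective (appendFactor k) := by
  intro p
  change p ∈ (appendFactor k).range
  have hC : ∀ r, Polynomial.C r ∈ (appendFactor k).range := by
    intro r
    induction r using MvPolynomial.induction_on with
    | C c => exact (appendFactor k).range.algebraMap_mem c
    | add p q hp hq => rw [map_add]; exact add_mem hp hq
    | mul_X p i hp =>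
      rw [map_mul]
      refine mul_mem hp ⟨divFactor (k + 1) (i + 1), ?_⟩
      exact (appendFactor_divFactor k _).trans (by simp [xiBar])
  induction p using Polynomial.induction_on' with
  | add p q hp hq => exact add_mem hp hq
  | monomial n r =>
    rw [← Polynomial.C_mul_X_pow_eq_monomial]
    have hX : Polynomial.X ∈ (appendFactor k).range := ⟨_, appendFactor_X k⟩
    exact mul_mem (hC r) (pow_mem hX n)

/-- An algebra map that kills `divFactor (k + 1) (k + 1)` factors through `appendFactor k`. -/
theorem exists_comp_appendFactor_eq {k : ℕ} {Q : Type*} [CommRing Q] [Algebra (ZMod 2) Q]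
    (π : Polynomial (MvPolynomial (Fin (k + 1)) (ZMod 2)) →ₐ[ZMod 2] Q)
    (hπ : π (divFactor (k + 1) (k + 1)) = 0) :
    ∃ ψ : Polynomial (MvPolynomial (Fin k) (ZMod 2)) →ₐ[ZMod 2] Q,
      ψ.comp (appendFactor k) = π := by
  let ψ : Polynomial (MvPolynomial (Fin k) (ZMod 2)) →ₐ[ZMod 2] Q :=
    Polynomial.eval₂AlgHom (aeval fun i : Fin k => π (divFactor (k + 1) (i + 1)))
      (π Polynomial.X) fun _ => Commute.all _ _
  have hψX : ψ Polynomial.X = π Polynomial.X := by simp [ψ]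
  have hψ : ∀ n ≤ k + 1, ψ (Polynomial.C (xiBar k n)) = π (divFactor (k + 1) n) := by
    intro n hn
    cases n with
    | zero => simp [xiBar, divFactor]
    | succ n =>
      by_cases h : n < k
      · simp [xiBar, h, ψ]
      · obtain rfl : n = k := by omega
        simp [xiBar, hπ]
  refine ⟨ψ, Polynomial.algHom_ext' (MvPolynomial.algHom_ext fun i => ?_) ?_⟩
  · have hi : (X i : MvPolynomial (Fin (k + 1)) (ZMod 2)) = xiBar (k + 1) (i + 1) := by
      rw [xiBar, dif_pos i.2]
    have h2 : (2 : Q) = 0 :=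
      (map_ofNat π 2).symm.trans ((congrArg π CharTwo.two_eq_zero).trans (map_zero π))
    simp only [AlgHom.comp_apply, Polynomial.CAlgHom_apply]
    rw [hi, appendFactor_xiBar_succ, map_add, map_mul, map_pow, hψX, hψ (i + 1) i.2,
      hψ i i.2.le, divFactor, map_add, map_mul, map_pow]
    linear_combination (π (divFactor (k + 1) i) * π Polynomial.X ^ 2 ^ (i : ℕ)) * h2
  · rw [AlgHom.comp_apply, appendFactor_X, hψX]

theorem ker_appendFactor (k : ℕ) :
    RingHom.ker (appendFactor k) = Ideal.span {divFactor (k + 1) (k + 1)} := by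
  apply le_antisymm
  · intro p hp
    obtain ⟨ψ, hψ⟩ := exists_comp_appendFactor_eq (Q := _ ⧸ Ideal.span {divFactor (k + 1) (k + 1)})
      (Ideal.Quotient.mkₐ (ZMod 2) (Ideal.span {divFactor (k + 1) (k + 1)}))
      (Ideal.Quotient.eq_zero_iff_mem.2
        (Ideal.mem_span_singleton_self (divFactor (k + 1) (k + 1))))
    rw [RingHom.mem_ker] at hp
    refine Ideal.Quotient.eq_zero_iff_mem.1 ((DFunLike.congr_fun hψ p).symm.trans ?_)
    rw [AlgHom.comp_apply, hp, map_zero]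
  · rw [Ideal.span_singleton_le_iff_mem, RingHom.mem_ker, appendFactor_divFactor]
    simp [xiBar]

theorem appendFactor_zetaBar_succ (k n : ℕ) :
    appendFactor k (Polynomial.C (zetaBar (k + 1) (n + 1))) =
      Polynomial.X * appendFactor k (Polynomial.C (zetaBar (k + 1) n)) ^ 2 +
        Polynomial.C (zetaBar k (n + 1)) := by
  let f := (appendFactor k).toRingHom.comp Polynomial.C
  refine leftInverse_succ (x := fun i => f (xiBar (k + 1) i))
    (y := fun i => Polynomial.C (xiBar k i)) (z := fun i => f (zetaBar (k + 1) i))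
    (w := fun i => Polynomial.C (zetaBar k i)) ?_ ?_ (appendFactor_xiBar_succ k) ?_ ?_ n
  · simp [xiBar]
  · simp [xiBar]
  · intro n
    rw [twistedConv_map, twistedConv_zetaBar_xiBar, apply_ite f, map_one, map_zero]
  · intro n
    rw [twistedConv_map, twistedConv_zetaBar_xiBar, apply_ite Polynomial.C, map_one, map_zero]

theorem appendFactor_zetaBar_monic (k n : ℕ) :
    (appendFactor k (Polynomial.C (zetaBar (k + 1) n))).Monic ∧
      (appendFactor k (Polynomial.C (zetaBar (k + 1) n))).natDegree + 1 = 2 ^ n := by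
  induction n with
  | zero => simp [zetaBar, zeta]
  | succ n ih =>
    have hm := Polynomial.monic_X.mul (ih.1.pow 2)
    have hd := Polynomial.monic_X.natDegree_mul (ih.1.pow 2)
    rw [ih.1.natDegree_pow, Polynomial.natDegree_X] at hd
    rw [appendFactor_zetaBar_succ, Polynomial.natDegree_add_C]
    exact ⟨monic_add_C_of_natDegree_pos hm (by omega) _, by rw [pow_succ (2 : ℕ) n]; omega⟩

/-- The ideal `(ζ̄_{m+1}, …, ζ̄_{m+k})` of `A⟨k⟩`. -/
noncomputable def zetaBarIdeal (k m : ℕ) : Ideal (MvPolynomial (Fin k) (ZMod 2)) :=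
  Ideal.span (Set.range fun i : Fin k => zetaBar k (m + 1 + (i : ℕ)))

theorem zetaBar_mem_zetaBarIdeal {k m n : ℕ} (h₁ : m < n) (h₂ : n ≤ m + k) :
    zetaBar k n ∈ zetaBarIdeal k m := by
  refine Ideal.subset_span ⟨⟨n - (m + 1), by omega⟩, ?_⟩
  simp only
  congr 1
  omega

theorem map_zetaBarIdeal (k m : ℕ) :
    ((zetaBarIdeal (k + 1) m).map Polynomial.C).map (appendFactor k) =
      (zetaBarIdeal k (m + 1)).map Polynomial.C ⊔
        Ideal.span {appendFactor k (Polynomial.C (zetaBar (k + 1) (m + 1)))} := by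
  have hmem : ∀ n, m < n → n ≤ m + (k + 1) → appendFactor k (Polynomial.C (zetaBar (k + 1) n)) ∈
      ((zetaBarIdeal (k + 1) m).map Polynomial.C).map (appendFactor k) := fun n h₁ h₂ =>
    Ideal.mem_map_of_mem _ (Ideal.mem_map_of_mem _ (zetaBar_mem_zetaBarIdeal h₁ h₂))
  apply le_antisymm
  · rw [Ideal.map_le_iff_le_comap, Ideal.map_le_iff_le_comap, zetaBarIdeal, Ideal.span_le]
    rintro _ ⟨⟨i, hi⟩, rfl⟩
    simp only [SetLike.mem_coe, Ideal.mem_comap]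
    induction i with
    | zero => exact Ideal.mem_sup_right (Ideal.mem_span_singleton_self _)
    | succ i ih =>
      rw [← add_assoc, appendFactor_zetaBar_succ k (m + 1 + i)]
      refine add_mem (Ideal.mul_mem_left _ _ (Ideal.pow_mem_of_mem _ (ih (by omega)) 2 two_pos)) ?_
      exact Ideal.mem_sup_left
        (Ideal.mem_map_of_mem _ (zetaBar_mem_zetaBarIdeal (by omega) (by omega)))
  · refine sup_le ?_ ?_
    · rw [Ideal.map_le_iff_le_comap, zetaBarIdeal, Ideal.span_le]
      rintro _ ⟨⟨i, hi⟩, rfl⟩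
      have h := appendFactor_zetaBar_succ k (m + 1 + i)
      rw [← sub_eq_iff_eq_add'] at h
      simp only [SetLike.mem_coe, Ideal.mem_comap]
      rw [add_right_comm (m + 1) 1 i, ← h]
      exact sub_mem (hmem _ (by omega) (by omega))
        (Ideal.mul_mem_left _ _ (Ideal.pow_mem_of_mem _ (hmem _ (by omega) (by omega)) 2 two_pos))
    · rw [Ideal.span_singleton_le_iff_mem]
      exact hmem _ (by omega) (by omega)

/-- Both sides are the quotient of `A⟨k⟩[a]` by the image of `(ζ̄_{m+1}, …, ζ̄_{m+k+1})`. -/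
theorem nonempty_pi_quotient_zetaBarIdeal_equiv (k m : ℕ) :
    Nonempty ((Fin (2 ^ (k + 1) - 1) →
        MvPolynomial (Fin (k + 1)) (ZMod 2) ⧸ zetaBarIdeal (k + 1) m) ≃ₗ[ZMod 2]
      (Fin (2 ^ (m + 1) - 1) → MvPolynomial (Fin k) (ZMod 2) ⧸ zetaBarIdeal k (m + 1))) := by
  obtain ⟨hf, hfd⟩ := divFactor_monic (k + 1) (k + 1)
  obtain ⟨hp, hpd⟩ := appendFactor_zetaBar_monic k (m + 1)
  obtain ⟨e₁⟩ := nonempty_quotient_map_C_sup_span_equiv (F := ZMod 2) (zetaBarIdeal (k + 1) m) hf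
  obtain ⟨e₂⟩ := nonempty_quotient_map_C_sup_span_equiv (F := ZMod 2) (zetaBarIdeal k (m + 1)) hp
  rw [← map_zetaBarIdeal] at e₂
  rw [eq_tsub_of_add_eq hfd] at e₁
  rw [eq_tsub_of_add_eq hpd] at e₂
  set K := (zetaBarIdeal (k + 1) m).map
    (Polynomial.C : _ →+* Polynomial (MvPolynomial (Fin (k + 1)) (ZMod 2)))
  let φ := (Ideal.Quotient.mkₐ (ZMod 2) (K.map (appendFactor k))).comp (appendFactor k)
  have hφ : Function.Surjective φ :=
    (Ideal.Quotient.mkₐ_surjective (ZMod 2) _).comp (appendFactor_surjective k)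
  have hker : RingHom.ker φ = K ⊔ Ideal.span {divFactor (k + 1) (k + 1)} := by
    have h : RingHom.ker φ = (K.map (appendFactor k)).comap (appendFactor k) := by
      ext r
      simp [φ, RingHom.mem_ker, Ideal.Quotient.eq_zero_iff_mem]
    rw [h, Ideal.comap_map_of_surjective _ (appendFactor_surjective k), ← ker_appendFactor]
    rfl
  let e := (Ideal.quotientEquivAlgOfEq (ZMod 2) hker.symm).trans
    (Ideal.quotientKerAlgEquivOfSurjective hφ)
  exact ⟨e₁.symm.trans (e.toLinearEquiv.trans e₂)⟩

theorem finrank_quotient_zetaBarIdeal (k m : ℕ) :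
    FiniteDimensional (ZMod 2) (MvPolynomial (Fin k) (ZMod 2) ⧸ zetaBarIdeal k m) ∧
    Module.finrank (ZMod 2) (MvPolynomial (Fin k) (ZMod 2) ⧸ zetaBarIdeal k m) *
        ∏ i ∈ Finset.range k, (2 ^ (i + 1) - 1) =
      ∏ i ∈ Finset.range k, (2 ^ (m + i + 1) - 1) := by
  induction k generalizing m with
  | zero =>
    have hI : zetaBarIdeal 0 m = ⊥ := by simp [zetaBarIdeal]
    let e : (MvPolynomial (Fin 0) (ZMod 2) ⧸ zetaBarIdeal 0 m) ≃ₗ[ZMod 2] ZMod 2 :=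
      (((Ideal.quotientEquivAlgOfEq (ZMod 2) hI).trans (AlgEquiv.quotientBot _ _)).trans
        (isEmptyAlgEquiv (ZMod 2) (Fin 0))).toLinearEquiv
    exact ⟨e.symm.finiteDimensional, by simp [e.finrank_eq]⟩
  | succ k ih =>
    obtain ⟨hfin, hrank⟩ := ih (m + 1)
    obtain ⟨e⟩ := nonempty_pi_quotient_zetaBarIdeal_equiv k m
    have hpos : 0 < 2 ^ (k + 1) - 1 := Nat.sub_pos_of_lt (Nat.one_lt_two_pow (by omega))
    have hpi := e.symm.finiteDimensional
    have hfin' : FiniteDimensional (ZMod 2)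
        (MvPolynomial (Fin (k + 1)) (ZMod 2) ⧸ zetaBarIdeal (k + 1) m) :=
      Module.Finite.of_surjective (LinearMap.proj (R := ZMod 2) (φ := fun _ =>
        MvPolynomial (Fin (k + 1)) (ZMod 2) ⧸ zetaBarIdeal (k + 1) m)
        (⟨0, hpos⟩ : Fin (2 ^ (k + 1) - 1))) (LinearMap.proj_surjective _)
    refine ⟨hfin', ?_⟩
    have he := e.finrank_eq
    simp only [Module.finrank_pi_fintype, Finset.sum_const, Finset.card_univ, Fintype.card_fin,
      smul_eq_mul] at he
    rw [Finset.prod_range_succ, Finset.prod_range_succ', mul_comm (∏ i ∈ _, _) (_ - 1), ← mul_assoc,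
      mul_comm _ (_ - 1), he, mul_assoc, hrank, mul_comm]
    congr 1
    exact Finset.prod_congr rfl fun i _ => by rw [add_right_comm m 1 i, add_assoc m i 1]

/-- STATEMENT 7: For `k ≥ 1`, `m ≥ 0`, the quotient `A⟨k⟩/(ζ̄_{m+1}, …, ζ̄_{m+k})`
is a finite-dimensional `F₂`-vector space whose dimension `d` satisfies
`d ⬝ ∏_{i=1}^k (2^i − 1) = ∏_{i=1}^k (2^{m+i} − 1)`, i.e. `d` is the Gaussian
binomial coefficient `(m+k choose k)_q` at `q = 2`. -/
theorem quotient_zetaBar_dim_gaussian (k m : ℕ) (hk : 1 ≤ k)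
    (I : Ideal (MvPolynomial (Fin k) (ZMod 2)))
    (hI : I = Ideal.span (Set.range fun i : Fin k => zetaBar k (m + 1 + (i : ℕ)))) :
    FiniteDimensional (ZMod 2) (MvPolynomial (Fin k) (ZMod 2) ⧸ I) ∧
    Module.finrank (ZMod 2) (MvPolynomial (Fin k) (ZMod 2) ⧸ I) *
        ∏ i ∈ Finset.range k, (2 ^ (i + 1) - 1) =
      ∏ i ∈ Finset.range k, (2 ^ (m + i + 1) - 1) := by
  subst hI
  exact finrank_quotient_zetaBarIdeal k m
end
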